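/- arXiv:math/0004080 — 2 statements merged into one kernel-verified Lean document; each statement's English description precedes it below -/
import Mathlib

section
/- Let G be a finite simple graph on a finite vertex type V and let A, B be distinct vertices of G. Then the rank over ℤ/2ℤ of the adjacency matrix of G equals the rank over ℤ/2ℤ of the adjacency matrix of G̃_{AB}, and the determinant over ℤ/2ℤ of the adjacency matrix of G equals the determinant over ℤ/2ℤ of the adjacency matrix of G̃_{AB}. (In particular, applying this to G'_{AB}, the rank and determinant also satisfy the second 2-term relation rank(G'_{AB}) = rank(G̃'_{AB}) and det(G'_{AB}) = det(G̃'_{AB}).) -/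
open Matrix

/-- The graph obtained from `G` by toggling (adding if absent, deleting if present)
the edge `{A, B}`. -/
def toggleEdge {V : Type*} (G : SimpleGraph V) (A B : V) : SimpleGraph V :=
  SimpleGraph.fromEdgeSet (symmDiff G.edgeSet {s(A, B)})

/-- The graph `G̃_{AB}`: toggle the edge `{A, C}` for every vertex `C ∉ {A, B}`
that is adjacent to `B` in `G`; all other adjacencies are unchanged. -/
def gTilde {V : Type*} (G : SimpleGraph V) (A B : V) : SimpleGraph V :=
  SimpleGraph.fromEdgeSet (symmDiff G.edgeSet
    {e | ∃ C, C ≠ A ∧ C ≠ B ∧ G.Adj B C ∧ e = s(A, C)})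

open Classical in
/-- The adjacency matrix of a simple graph over the field `ℤ/2ℤ`. -/
noncomputable def adjMat {V : Type*} (G : SimpleGraph V) : Matrix V V (ZMod 2) :=
  Matrix.of fun i j => if G.Adj i j then 1 else 0

theorem toggleEdge_adj {V : Type*} (G : SimpleGraph V) (A B i j : V) :
    (toggleEdge G A B).Adj i j ↔ i ≠ j ∧ Xor (G.Adj i j) (i = A ∧ j = B ∨ i = B ∧ j = A) := by
  simp only [toggleEdge, SimpleGraph.fromEdgeSet_adj, Set.mem_symmDiff, SimpleGraph.mem_edgeSet,
    Set.mem_singleton_iff, Sym2.eq_iff, Xor]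
  tauto

theorem gTilde_adj {V : Type*} (G : SimpleGraph V) (A B i j : V) :
    (gTilde G A B).Adj i j ↔ i ≠ j ∧ Xor (G.Adj i j)
      (i = A ∧ j ≠ A ∧ j ≠ B ∧ G.Adj B j ∨ j = A ∧ i ≠ A ∧ i ≠ B ∧ G.Adj B i) := by
  have key : (∃ C, C ≠ A ∧ C ≠ B ∧ G.Adj B C ∧ s(i, j) = s(A, C)) ↔
      (i = A ∧ j ≠ A ∧ j ≠ B ∧ G.Adj B j ∨ j = A ∧ i ≠ A ∧ i ≠ B ∧ G.Adj B i) := by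
    simp only [Sym2.eq_iff]
    constructor
    · rintro ⟨C, h1, h2, h3, ⟨rfl, rfl⟩ | ⟨rfl, rfl⟩⟩ <;> tauto
    · rintro (⟨rfl, h⟩ | ⟨rfl, h⟩)
      · exact ⟨j, h.1, h.2.1, h.2.2, by tauto⟩
      · exact ⟨i, h.1, h.2.1, h.2.2, by tauto⟩
  simp only [gTilde, SimpleGraph.fromEdgeSet_adj, Set.mem_symmDiff, SimpleGraph.mem_edgeSet,
    Set.mem_ofPred_eq, key, Xor]
  exact and_comm

theorem gTilde_toggleEdge {V : Type*} (G : SimpleGraph V) (A B : V) :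
    gTilde (toggleEdge G A B) A B = toggleEdge (gTilde G A B) A B := by
  ext i j
  simp only [gTilde_adj, toggleEdge_adj, Xor]
  grind

theorem adjMat_apply_congr {V : Type*} {G H : SimpleGraph V} {i j : V}
    (h : G.Adj i j ↔ H.Adj i j) : adjMat G i j = adjMat H i j := by
  classical
  exact if_congr h rfl rfl

/-- Passing to `gTilde G A B` adds row `B` to row `A` and column `B` to column `A`. -/
theorem adjMat_gTilde {V : Type*} [Fintype V] [DecidableEq V]
    (G : SimpleGraph V) {A B : V} (hAB : A ≠ B) :
    adjMat (gTilde G A B) = transvection A B 1 * adjMat G * transvection B A 1 := by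
  have two : (1 : ZMod 2) + 1 = 0 := by decide
  ext i j
  have hs := G.adj_comm
  by_cases hi : i = A <;> by_cases hj : j = A
  · subst hi hj
    by_cases h : G.Adj B j <;> simp [adjMat, hs j B, h, two]
  · subst hi
    rw [mul_transvection_apply_of_ne _ _ _ _ hj, transvection_mul_apply_same]
    by_cases hB : j = B
    · subst hB
      have : (gTilde G i j).Adj i j ↔ G.Adj i j := by simp [gTilde_adj, Xor, hAB, hj]
      rw [adjMat_apply_congr this]
      simp [adjMat]
    · by_cases h : G.Adj B j <;> by_cases h' : G.Adj i j <;>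
        simp [adjMat, gTilde_adj, Xor, hj, hB, h, h', two, Ne.symm hj]
  · subst hj
    rw [mul_transvection_apply_same, transvection_mul_apply_of_ne _ _ _ _ hi,
      transvection_mul_apply_of_ne _ _ _ _ hi]
    by_cases hB : i = B
    · subst hB
      have : (gTilde G j i).Adj i j ↔ G.Adj i j := by simp [gTilde_adj, Xor, hi]
      rw [adjMat_apply_congr this]
      simp [adjMat]
    · by_cases h : G.Adj B i <;> by_cases h' : G.Adj i j <;>
        simp [adjMat, gTilde_adj, Xor, hi, hB, h, h', two, hs i B]
  · rw [mul_transvection_apply_of_ne _ _ _ _ hj, transvection_mul_apply_of_ne _ _ _ _ hi]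
    have : (gTilde G A B).Adj i j ↔ G.Adj i j := by
      simpa [gTilde_adj, Xor, hi, hj] using fun h : G.Adj i j => h.ne
    exact adjMat_apply_congr this

theorem rank_adjMat_gTilde {V : Type*} [Fintype V]
    (G : SimpleGraph V) {A B : V} (hAB : A ≠ B) :
    (adjMat (gTilde G A B)).rank = (adjMat G).rank := by
  classical
  rw [adjMat_gTilde G hAB, rank_mul_eq_left_of_isUnit_det, rank_mul_eq_right_of_isUnit_det]
  · simp [det_transvection_of_ne _ _ hAB]
  · simp [det_transvection_of_ne _ _ hAB.symm]

theorem det_adjMat_gTilde {V : Type*} [Fintype V] [DecidableEq V]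
    (G : SimpleGraph V) {A B : V} (hAB : A ≠ B) :
    (adjMat (gTilde G A B)).det = (adjMat G).det := by
  rw [adjMat_gTilde G hAB, det_mul, det_mul, det_transvection_of_ne _ _ hAB,
    det_transvection_of_ne _ _ hAB.symm, one_mul, mul_one]

/-- The rank and determinant over `ℤ/2ℤ` of the adjacency matrix of `G` equal
those of `G̃_{AB}`; in particular (applying this to `G'_{AB}`), the rank and
determinant also satisfy the second 2-term relation `rank(G'_{AB}) = rank(G̃'_{AB})`
and `det(G'_{AB}) = det(G̃'_{AB})`. -/
theorem rank_det_two_term {V : Type*} [Fintype V] [DecidableEq V]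
    (G : SimpleGraph V) (A B : V) (hAB : A ≠ B) :
    (adjMat G).rank = (adjMat (gTilde G A B)).rank ∧
    (adjMat G).det = (adjMat (gTilde G A B)).det ∧
    (adjMat (toggleEdge G A B)).rank = (adjMat (toggleEdge (gTilde G A B) A B)).rank ∧
    (adjMat (toggleEdge G A B)).det = (adjMat (toggleEdge (gTilde G A B) A B)).det := by
  rw [← gTilde_toggleEdge]
  exact ⟨(rank_adjMat_gTilde G hAB).symm, (det_adjMat_gTilde G hAB).symm,
    (rank_adjMat_gTilde _ hAB).symm, (det_adjMat_gTilde _ hAB).symm⟩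
end

section
/- Let k ≥ 1 and let σ be a fixed-point-free involution of ZMod (2k) (a chord diagram of degree k). Let c(σ) be the number of orbits of the permutation of ZMod (2k) given by i ↦ σ(i + 1). Then the rank over ℤ/2ℤ of the adjacency matrix of the intersection graph Γ(σ) equals k − c(σ) + 1. (Equivalently, the HOMFLYPT regular weight system satisfies H(D) = a^k b^{k − rank(Γ(D))}, since surgering all chords of D yields a link with c(σ) components.) -/
open Matrix

/-- The type of chords of the chord diagram given by a fixed-point-free
involution `σ` of `ZMod (2k)`: each chord is represented by its endpoint with
the smaller representative in `{0, 1, …, 2k−1}`. -/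
abbrev Chord (k : ℕ) (σ : Equiv.Perm (ZMod (2 * k))) : Type :=
  {i : ZMod (2 * k) // i.val < (σ i).val}

/-- Two chords `{a, σ a}` and `{c, σ c}` (with `a.val < (σ a).val` and
`c.val < (σ c).val`) interlace iff exactly one of `c`, `σ c` lies strictly
between `a` and `σ a`. -/
def Interlace (k : ℕ) (σ : Equiv.Perm (ZMod (2 * k))) (a c : ZMod (2 * k)) : Prop :=
  Xor' (a.val < c.val ∧ c.val < (σ a).val) (a.val < (σ c).val ∧ (σ c).val < (σ a).val)

open Classical in
/-- The adjacency matrix over `ℤ/2ℤ` of the intersection graph `Γ(σ)` of the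
chord diagram `σ`: two distinct chords are adjacent iff they interlace. -/
noncomputable def interMat (k : ℕ) (σ : Equiv.Perm (ZMod (2 * k))) :
    Matrix (Chord k σ) (Chord k σ) (ZMod 2) :=
  Matrix.of fun a c => if a ≠ c ∧ Interlace k σ a.1 c.1 then 1 else 0

/-- The setoid on `α` whose classes are the orbits of the permutation `τ`. -/
def cycleSetoid {α : Type*} (τ : Equiv.Perm α) : Setoid α where
  r := τ.SameCycle
  iseqv := ⟨fun x => Equiv.Perm.SameCycle.refl τ x,
    fun h => h.symm, fun h h' => h.trans h'⟩


theorem ZMod.sum_between_sub {N : ℕ} [NeZero N] {A : Type*} [AddCommGroup A]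
    (G : ZMod N → A) {a b : ZMod N} (h : a.val < b.val) :
    ∑ p with a.val < p.val ∧ p.val < b.val, (G p - G (p - 1)) = G (b - 1) - G a := by
  have key : ∑ p with a.val < p.val ∧ p.val < b.val, (G p - G (p - 1)) =
      ∑ n ∈ Finset.Ico (a.val + 1) b.val,
        (G (((n + 1 : ℕ) : ZMod N) - 1) - G ((n : ZMod N) - 1)) := by
    refine Finset.sum_nbij ZMod.val ?_ ?_ ?_ ?_
    · intro p hp
      simp only [Finset.mem_filter, Finset.mem_Ico] at hp ⊢
      omega
    · exact (ZMod.val_injective N).injOn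
    · intro n hn
      simp only [Finset.coe_Ico, Set.mem_Ico] at hn
      have hv : ((n : ZMod N)).val = n := ZMod.val_cast_of_lt (hn.2.trans b.val_lt)
      refine ⟨n, ?_, hv⟩
      simp only [Finset.coe_filter, Finset.mem_univ, true_and, Set.mem_ofPred_eq, hv]
      omega
    · intro p _
      simp
  rw [key, Finset.sum_Ico_sub (fun n : ℕ => G ((n : ZMod N) - 1)) h]
  simp

/-- Every function on `ZMod N` with vanishing total sum is a backward difference. -/
theorem ZMod.exists_sub_eq_of_sum_eq_zero {N : ℕ} [NeZero N] {A : Type*} [AddCommGroup A]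
    (X : ZMod N → A) (hX : ∑ p, X p = 0) : ∃ G : ZMod N → A, ∀ p, G p - G (p - 1) = X p := by
  have hsum : ∑ n ∈ Finset.range N, X n = 0 := by
    rw [← hX]
    refine (Finset.sum_nbij ZMod.val ?_ (ZMod.val_injective N).injOn ?_ ?_).symm
    · intro p _
      simpa using p.val_lt
    · intro n hn
      simp only [Finset.coe_range, Set.mem_Iio] at hn
      exact ⟨n, by simp, ZMod.val_cast_of_lt hn⟩
    · intro p _
      simp
  refine ⟨fun p => ∑ n ∈ Finset.range (p.val + 1), X n, fun p => ?_⟩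
  have hstep : ∑ n ∈ Finset.range ((p - 1).val + 1), X n = ∑ n ∈ Finset.range p.val, X n := by
    obtain hp | hp := Nat.eq_zero_or_pos p.val
    · have hp0 : p = 0 := (ZMod.val_eq_zero p).1 hp
      obtain ⟨M, rfl⟩ := Nat.exists_eq_succ_of_ne_zero (NeZero.ne N)
      subst hp0
      rw [zero_sub, ZMod.val_neg_one, hsum]
      simp
    · have hN : 1 < N := by have := p.val_lt; omega
      have : Fact (1 < N) := ⟨hN⟩
      rw [ZMod.val_sub (by rw [ZMod.val_one]; exact hp), ZMod.val_one, Nat.sub_add_cancel hp]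
  beta_reduce
  rw [hstep, Finset.sum_range_succ]
  simp

section ChordDiagram

variable {k : ℕ} {σ : Equiv.Perm (ZMod (2 * k))}

/-- Every point is an endpoint of exactly one chord. -/
theorem sum_eq_sum_chord [NeZero (2 * k)] {A : Type*} [AddCommMonoid A]
    (hinv : ∀ i, σ (σ i) = i) (hfix : ∀ i, σ i ≠ i) (f : ZMod (2 * k) → A) :
    ∑ p, f p = ∑ c : Chord k σ, (f c.1 + f (σ c.1)) := by
  rw [Finset.sum_add_distrib, ← Finset.sum_filter_add_sum_filter_not _
    (fun p : ZMod (2 * k) => p.val < (σ p).val)]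
  congr 1
  · exact Finset.sum_subtype _ (by simp) f
  · rw [← Finset.sum_subtype (Finset.univ.filter fun p : ZMod (2 * k) => p.val < (σ p).val)
      (by simp) (fun p => f (σ p))]
    refine Finset.sum_nbij' σ σ ?_ ?_ ?_ ?_ ?_
    · intro p hp
      have := (ZMod.val_injective (2 * k)).ne (hfix p)
      simp only [Finset.mem_filter, Finset.mem_univ, true_and, hinv] at hp ⊢
      omega
    · intro p hp
      simp only [Finset.mem_filter, Finset.mem_univ, true_and, hinv] at hp ⊢
      omega
    all_goals simp [hinv]

theorem card_chord [NeZero (2 * k)] (hinv : ∀ i, σ (σ i) = i) (hfix : ∀ i, σ i ≠ i) :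
    Fintype.card (Chord k σ) = k := by
  have h := sum_eq_sum_chord hinv hfix (fun _ => 1)
  simp only [Finset.sum_const, Finset.card_univ, ZMod.card, smul_eq_mul] at h
  omega

/-- The matrix of the intersection graph sums an extended vector over the points strictly
between the endpoints of a chord. -/
theorem interMat_mulVec [NeZero (2 * k)] (hinv : ∀ i, σ (σ i) = i) (hfix : ∀ i, σ i ≠ i)
    (X : ZMod (2 * k) → ZMod 2) (hX : ∀ p, X (σ p) = X p) (a : Chord k σ) :
    (interMat k σ *ᵥ fun c => X c.1) a =
      ∑ p with a.1.val < p.val ∧ p.val < (σ a.1).val, X p := by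
  classical
  rw [Finset.sum_filter, sum_eq_sum_chord hinv hfix]
  refine Finset.sum_congr rfl fun c _ => ?_
  have h2 : X c.1 + X c.1 = 0 := CharTwo.add_self_eq_zero _
  simp only [interMat, of_apply, hX, Interlace, Xor']
  by_cases hac : a = c
  · subst hac
    simp
  · by_cases h1 : a.1.val < c.1.val ∧ c.1.val < (σ a.1).val <;>
      by_cases h3 : a.1.val < (σ c.1).val ∧ (σ c.1).val < (σ a.1).val <;>
      simp [hac, h1, h3, h2]

/-- A vector indexed by chords is the restriction of a function on points that is constant
on chords. -/
theorem exists_extend_chord [NeZero (2 * k)] (hinv : ∀ i, σ (σ i) = i) (hfix : ∀ i, σ i ≠ i)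
    {A : Type*} (x : Chord k σ → A) :
    ∃ X : ZMod (2 * k) → A, (∀ p, X (σ p) = X p) ∧ ∀ c : Chord k σ, X c.1 = x c := by
  have hlt (p : ZMod (2 * k)) (hp : ¬ p.val < (σ p).val) : (σ p).val < (σ (σ p)).val := by
    have := (ZMod.val_injective (2 * k)).ne (hfix p)
    rw [hinv]
    omega
  refine ⟨fun p => if hp : p.val < (σ p).val then x ⟨p, hp⟩ else x ⟨σ p, hlt p hp⟩, ?_, ?_⟩
  · intro p
    by_cases hp : p.val < (σ p).val
    · have hp' : ¬ (σ p).val < p.val := by omega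
      simp [hp, hp', hinv]
    · have hp' := hlt p hp
      rw [hinv] at hp'
      simp [hp, hp', hinv]
  · intro c
    simp [c.2]

/-- The orbits of the permutation `i ↦ σ (i + 1)`. -/
abbrev ChordOrbit (k : ℕ) (σ : Equiv.Perm (ZMod (2 * k))) : Type :=
  Quotient (cycleSetoid ((Equiv.addRight (1 : ZMod (2 * k))).trans σ))

/-- The class of a point in the set of orbits of `i ↦ σ (i + 1)`. -/
def chordOrbitMk (k : ℕ) (σ : Equiv.Perm (ZMod (2 * k))) (i : ZMod (2 * k)) : ChordOrbit k σ :=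
  Quotient.mk _ i

theorem chordOrbitMk_apply_add_one (i : ZMod (2 * k)) :
    chordOrbitMk k σ (σ (i + 1)) = chordOrbitMk k σ i :=
  Quotient.sound (s := cycleSetoid _)
    (show Equiv.Perm.SameCycle ((Equiv.addRight (1 : ZMod (2 * k))).trans σ) _ _ from
      Equiv.Perm.sameCycle_apply_left.2 (Equiv.Perm.SameCycle.refl _ i))

theorem chordOrbitMk_apply (i : ZMod (2 * k)) :
    chordOrbitMk k σ (σ i) = chordOrbitMk k σ (i - 1) := by
  simpa using chordOrbitMk_apply_add_one (σ := σ) (i - 1)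

theorem exists_lift_chordOrbit {A : Type*} (G : ZMod (2 * k) → A)
    (hG : ∀ i, G (σ (i + 1)) = G i) :
    ∃ g : ChordOrbit k σ → A, ∀ i, g (chordOrbitMk k σ i) = G i := by
  set τ := (Equiv.addRight (1 : ZMod (2 * k))).trans σ with hτ
  refine ⟨Quotient.lift G ?_, fun _ => rfl⟩
  rintro a b ⟨n, rfl⟩
  have hpow (m : ℕ) (i : ZMod (2 * k)) : G ((τ ^ m) i) = G i := by
    induction m with
    | zero => rfl
    | succ m ih => rw [pow_succ', Equiv.Perm.mul_apply, ← ih]; exact hG _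
  obtain ⟨m, rfl | rfl⟩ := n.eq_nat_or_neg
  · exact (hpow m a).symm
  · rw [← hpow m ((τ ^ (-(m : ℤ))) a)]
    simp

/-- The map sending a function on the orbits to its backward differences along the chords. -/
def orbitDiff (k : ℕ) (σ : Equiv.Perm (ZMod (2 * k))) :
    (ChordOrbit k σ → ZMod 2) →ₗ[ZMod 2] (Chord k σ → ZMod 2) where
  toFun g c := g (chordOrbitMk k σ c.1) - g (chordOrbitMk k σ (c.1 - 1))
  map_add' g h := by ext c; simp only [Pi.add_apply]; ring
  map_smul' r g := by
    ext c; simp only [Pi.smul_apply, smul_eq_mul, RingHom.id_apply]; ring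

theorem chordOrbitMk_apply_sub_one (hinv : ∀ i, σ (σ i) = i) (i : ZMod (2 * k)) :
    chordOrbitMk k σ (σ i - 1) = chordOrbitMk k σ i := by
  rw [← chordOrbitMk_apply, hinv]

theorem diff_apply_eq_diff (hinv : ∀ i, σ (σ i) = i) (g : ChordOrbit k σ → ZMod 2)
    (p : ZMod (2 * k)) :
    g (chordOrbitMk k σ (σ p)) - g (chordOrbitMk k σ (σ p - 1)) =
      g (chordOrbitMk k σ p) - g (chordOrbitMk k σ (p - 1)) := by
  rw [chordOrbitMk_apply_sub_one hinv, chordOrbitMk_apply, CharTwo.sub_eq_add (g _),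
    CharTwo.sub_eq_add (g _), add_comm]

theorem range_orbitDiff [NeZero (2 * k)] (hinv : ∀ i, σ (σ i) = i) (hfix : ∀ i, σ i ≠ i) :
    LinearMap.range (orbitDiff k σ) = LinearMap.ker (interMat k σ).mulVecLin := by
  ext x
  rw [LinearMap.mem_range, LinearMap.mem_ker, mulVecLin_apply]
  constructor
  · rintro ⟨g, rfl⟩
    ext a
    refine (interMat_mulVec hinv hfix
      (fun p => g (chordOrbitMk k σ p) - g (chordOrbitMk k σ (p - 1)))
      (diff_apply_eq_diff hinv g) a).trans ?_
    rw [ZMod.sum_between_sub (fun p => g (chordOrbitMk k σ p)) a.2,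
      chordOrbitMk_apply_sub_one hinv, sub_self]
    rfl
  · intro hx
    obtain ⟨X, hX, hXx⟩ := exists_extend_chord hinv hfix x
    obtain ⟨G, hG⟩ := ZMod.exists_sub_eq_of_sum_eq_zero X (by
      rw [sum_eq_sum_chord hinv hfix]
      exact Finset.sum_eq_zero fun c _ => by rw [hX, CharTwo.add_self_eq_zero])
    have hchord (a : Chord k σ) : G (σ a.1 - 1) = G a.1 := by
      rw [← sub_eq_zero, ← ZMod.sum_between_sub G a.2]
      simp only [hG]
      rw [← interMat_mulVec hinv hfix X hX, funext hXx, hx]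
      rfl
    have hchord' (a : Chord k σ) : G (a.1 - 1) = G (σ a.1) := by
      have h1 := hG a.1
      have h2 := hG (σ a.1)
      rw [hX, ← h1, hchord, CharTwo.sub_eq_add (G _), CharTwo.sub_eq_add (G _), add_comm] at h2
      exact (add_left_cancel h2).symm
    have hall (p : ZMod (2 * k)) : G (σ p) = G (p - 1) := by
      by_cases hp : p.val < (σ p).val
      · exact (hchord' ⟨p, hp⟩).symm
      · have := (ZMod.val_injective (2 * k)).ne (hfix p)
        have h := hchord ⟨σ p, by rw [hinv]; omega⟩
        simp only [hinv] at h
        exact h.symm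
    obtain ⟨g, hg⟩ := exists_lift_chordOrbit (σ := σ) G fun i => by simp [hall]
    refine ⟨g, funext fun c => ?_⟩
    simp only [orbitDiff, LinearMap.coe_mk, AddHom.coe_mk, hg, hG, hXx]

theorem ker_orbitDiff [NeZero (2 * k)] (hinv : ∀ i, σ (σ i) = i) (hfix : ∀ i, σ i ≠ i) :
    LinearMap.ker (orbitDiff k σ) = Submodule.span (ZMod 2) {fun _ => 1} := by
  ext g
  rw [LinearMap.mem_ker, Submodule.mem_span_singleton]
  constructor
  · intro hg
    have hchord (c : Chord k σ) : g (chordOrbitMk k σ c.1) - g (chordOrbitMk k σ (c.1 - 1)) = 0 :=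
      congrFun hg c
    have hall (p : ZMod (2 * k)) : g (chordOrbitMk k σ p) = g (chordOrbitMk k σ (p - 1)) := by
      rw [← sub_eq_zero]
      by_cases hp : p.val < (σ p).val
      · exact hchord ⟨p, hp⟩
      · have := (ZMod.val_injective (2 * k)).ne (hfix p)
        rw [← diff_apply_eq_diff hinv]
        exact hchord ⟨σ p, by rw [hinv]; omega⟩
    have hconst (n : ℕ) : g (chordOrbitMk k σ (n : ZMod (2 * k))) = g (chordOrbitMk k σ 0) := by
      induction n with
      | zero => simp
      | succ n ih => rw [hall, ← ih]; simp
    refine ⟨g (chordOrbitMk k σ 0), funext fun q => ?_⟩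
    obtain ⟨p, rfl⟩ := Quotient.exists_rep q
    have := hconst p.val
    rw [ZMod.natCast_zmod_val] at this
    simpa using! this.symm
  · rintro ⟨r, rfl⟩
    ext c
    simp [orbitDiff]

end ChordDiagram

/-- For a chord diagram `σ` of degree `k ≥ 1`, the rank over `ℤ/2ℤ` of the
adjacency matrix of the intersection graph `Γ(σ)` equals `k − c(σ) + 1`, where
`c(σ)` is the number of orbits of the permutation `i ↦ σ (i + 1)` of `ZMod (2k)`. -/
theorem rank_interMat_eq (k : ℕ) (hk : 1 ≤ k) [NeZero (2 * k)]
    (σ : Equiv.Perm (ZMod (2 * k)))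
    (hinv : ∀ i, σ (σ i) = i) (hfix : ∀ i, σ i ≠ i) :
    ((interMat k σ).rank : ℤ) =
      (k : ℤ) - (Nat.card (Quotient (cycleSetoid
        ((Equiv.addRight (1 : ZMod (2 * k))).trans σ))) : ℤ) + 1 := by
  classical
  have : Finite (ChordOrbit k σ) := Quotient.finite _
  have : Fintype (ChordOrbit k σ) := Fintype.ofFinite _
  have h1 := LinearMap.finrank_range_add_finrank_ker (orbitDiff k σ)
  have h2 := LinearMap.finrank_range_add_finrank_ker (interMat k σ).mulVecLin
  have hone : (fun _ => 1 : ChordOrbit k σ → ZMod 2) ≠ 0 := fun h =>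
    one_ne_zero (congrFun h (chordOrbitMk k σ 0))
  rw [range_orbitDiff hinv hfix, ker_orbitDiff hinv hfix, finrank_span_singleton hone,
    Module.finrank_pi, ← Nat.card_eq_fintype_card] at h1
  rw [Module.finrank_pi, card_chord hinv hfix] at h2
  rw [Matrix.rank]
  change _ = (k : ℤ) - (Nat.card (ChordOrbit k σ) : ℤ) + 1
  omega
end
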